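/- Let (g,[·,·,·],T) be a Rota-Baxter 3-Lie algebra of weight λ. Then the derived bracket [·,·,·]_T is an alternating trilinear map on g satisfying the Fundamental Identity; that is, (g,[·,·,·]_T) is a 3-Lie algebra (denoted g_T). -/

import Mathlib

/-!
Basic notions for Rota-Baxter 3-Lie algebras of arbitrary weight,
following Guo–Qin–Wang–Zhou.
-/

namespace RBPaper

section Defs

variable (k : Type*) [Field k]
variable {g M E g₀ g₁ : Type*}
variable [AddCommGroup g] [Module k g] [AddCommGroup M] [Module k M]
variable [AddCommGroup E] [Module k E]
variable [AddCommGroup g₀] [Module k g₀] [AddCommGroup g₁] [Module k g₁]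

/-- A map `g → g → g → M` is trilinear. -/
structure Trilinear (f : g → g → g → M) : Prop where
  lin₁ : ∀ y z, IsLinearMap k fun x => f x y z
  lin₂ : ∀ x z, IsLinearMap k fun y => f x y z
  lin₃ : ∀ x y, IsLinearMap k fun z => f x y z

/-- A map of three arguments is alternating: it vanishes whenever two arguments coincide. -/
structure Alternating3 (f : g → g → g → M) : Prop where
  alt₁₂ : ∀ x y, f x x y = 0
  alt₂₃ : ∀ x y, f x y y = 0
  alt₁₃ : ∀ x y, f x y x = 0

/-- The Fundamental Identity of a ternary bracket. -/
def FundamentalIdentity (f : g → g → g → g) : Prop :=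
  ∀ x₁ x₂ x₃ x₄ x₅, f x₁ x₂ (f x₃ x₄ x₅) =
    f (f x₁ x₂ x₃) x₄ x₅ + f x₃ (f x₁ x₂ x₄) x₅ + f x₃ x₄ (f x₁ x₂ x₅)

/-- `f` is a 3-Lie algebra bracket on `g`. -/
structure Is3LieAlgebra (f : g → g → g → g) : Prop where
  tri : Trilinear k f
  alt : Alternating3 f
  fi : FundamentalIdentity f

/-- `T` is a Rota-Baxter operator of weight `lam` on `(g, f)`. -/
def IsRotaBaxterOp (lam : k) (f : g → g → g → g) (T : g → g) : Prop :=
  ∀ x y z, f (T x) (T y) (T z) =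
    T (f (T x) (T y) z + f (T x) y (T z) + f x (T y) (T z) +
       lam • f (T x) y z + lam • f x (T y) z + lam • f x y (T z) +
       (lam * lam) • f x y z)

/-- `(g, f, T)` is a Rota-Baxter 3-Lie algebra of weight `lam`. -/
structure IsRBThreeLie (lam : k) (f : g → g → g → g) (T : g → g) : Prop where
  lie : Is3LieAlgebra k f
  linT : IsLinearMap k T
  rb : IsRotaBaxterOp k lam f T

/-- `(M, ρ)` is a representation of the 3-Lie algebra `(g, f)`. -/
structure IsRep (f : g → g → g → g) (ρ : g → g → M → M) : Prop where
  lin₁ : ∀ y m, IsLinearMap k fun x => ρ x y m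
  lin₂ : ∀ x m, IsLinearMap k fun y => ρ x y m
  lin₃ : ∀ x y, IsLinearMap k (ρ x y)
  alt : ∀ x m, ρ x x m = 0
  rep₁ : ∀ x₁ x₂ x₃ x₄ m, ρ x₁ x₂ (ρ x₃ x₄ m) =
      ρ (f x₁ x₂ x₃) x₄ m + ρ x₃ (f x₁ x₂ x₄) m + ρ x₃ x₄ (ρ x₁ x₂ m)
  rep₂ : ∀ x₁ x₂ x₃ x₄ m, ρ x₁ (f x₂ x₃ x₄) m =
      ρ x₃ x₄ (ρ x₁ x₂ m) - ρ x₂ x₄ (ρ x₁ x₃ m) + ρ x₂ x₃ (ρ x₁ x₄ m)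

/-- `(M, ρ, TM)` is a representation of the Rota-Baxter 3-Lie algebra
`(g, f, T)` of weight `lam`. -/
structure IsRBRep (lam : k) (f : g → g → g → g) (T : g → g)
    (ρ : g → g → M → M) (TM : M → M) : Prop where
  rep : IsRep k f ρ
  linTM : IsLinearMap k TM
  rb : ∀ x y m, ρ (T x) (T y) (TM m) =
    TM (ρ (T x) (T y) m + ρ (T x) y (TM m) + ρ x (T y) (TM m) +
        lam • ρ (T x) y m + lam • ρ x (T y) m + lam • ρ x y (TM m) +
        (lam * lam) • ρ x y m)

/-- The derived bracket `[x,y,z]_T` of a Rota-Baxter 3-Lie algebra. -/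
def derBracket (lam : k) (f : g → g → g → g) (T : g → g) : g → g → g → g :=
  fun x y z =>
    f (T x) (T y) z + f (T x) y (T z) + f x (T y) (T z) +
      lam • f (T x) y z + lam • f x (T y) z + lam • f x y (T z) +
      (lam * lam) • f x y z

/-- A 2-cocycle `(ψ, χ)` of the Rota-Baxter 3-Lie algebra `(g, f, T)` of weight `lam`
with coefficients in the representation `(M, ρ, TM)`. -/
structure IsTwoCocycle (lam : k) (f : g → g → g → g) (T : g → g)
    (ρ : g → g → M → M) (TM : M → M) (ψ : g → g → g → M) (χ : g → M) : Prop where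
  tri : Trilinear k ψ
  alt : Alternating3 ψ
  lin : IsLinearMap k χ
  c1 : ∀ x₁ x₂ x₃ x₄ x₅,
    ρ x₁ x₂ (ψ x₃ x₄ x₅) + ψ x₁ x₂ (f x₃ x₄ x₅) =
      ψ (f x₁ x₂ x₃) x₄ x₅ + ψ x₃ (f x₁ x₂ x₄) x₅ + ψ x₃ x₄ (f x₁ x₂ x₅) +
        ρ x₄ x₅ (ψ x₁ x₂ x₃) + ρ x₅ x₃ (ψ x₁ x₂ x₄) + ρ x₃ x₄ (ψ x₁ x₂ x₅)
  c2 : ∀ x y z,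
    ρ (T x) (T y) (χ z) + ρ (T z) (T x) (χ y) + ρ (T y) (T z) (χ x) +
        ψ (T x) (T y) (T z) =
      TM (ρ (T y) z (χ x) + ρ z (T x) (χ y) + ψ (T x) (T y) z) + χ (f (T x) (T y) z) +
      TM (ρ (T x) y (χ z) + ρ y (T z) (χ x) + ψ (T x) y (T z)) + χ (f (T x) y (T z)) +
      TM (ρ x (T y) (χ z) + ρ (T z) x (χ y) + ψ x (T y) (T z)) + χ (f x (T y) (T z)) +
      lam • TM (ρ y z (χ x) + ψ (T x) y z) + lam • χ (f (T x) y z) +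
      lam • TM (ρ z x (χ y) + ψ x (T y) z) + lam • χ (f x (T y) z) +
      lam • TM (ρ x y (χ z) + ψ x y (T z)) + lam • χ (f x y (T z)) +
      (lam * lam) • χ (f x y z) + (lam * lam) • TM (ψ x y z)

/-- A 1-parameter formal deformation `(μ_i, 𝒯_i)` of the Rota-Baxter 3-Lie algebra
`(g, f, T)` of weight `lam`, given by its coefficientwise equations. -/
structure IsDeformation (lam : k) (f : g → g → g → g) (T : g → g)
    (μ : ℕ → g → g → g → g) (𝒯 : ℕ → g → g) : Prop where
  tri : ∀ i, Trilinear k (μ i)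
  alt : ∀ i, Alternating3 (μ i)
  lin : ∀ i, IsLinearMap k (𝒯 i)
  μ₀ : μ 0 = f
  𝒯₀ : 𝒯 0 = T
  fi : ∀ n x₁ x₂ x₃ x₄ x₅,
    ∑ i ∈ Finset.range (n + 1), μ i x₁ x₂ (μ (n - i) x₃ x₄ x₅) =
      ∑ i ∈ Finset.range (n + 1),
        (μ i (μ (n - i) x₁ x₂ x₃) x₄ x₅ + μ i x₃ (μ (n - i) x₁ x₂ x₄) x₅ +
          μ i x₃ x₄ (μ (n - i) x₁ x₂ x₅))
  rb : ∀ n x₁ x₂ x₃,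
    (∑ i ∈ Finset.range (n + 1), ∑ j ∈ Finset.range (n - i + 1),
        ∑ l ∈ Finset.range (n - i - j + 1),
        μ i (𝒯 j x₁) (𝒯 l x₂) (𝒯 (n - i - j - l) x₃)) =
      (∑ i ∈ Finset.range (n + 1), ∑ j ∈ Finset.range (n - i + 1),
          ∑ l ∈ Finset.range (n - i - j + 1),
          𝒯 i (μ j (𝒯 l x₁) (𝒯 (n - i - j - l) x₂) x₃ +
               μ j (𝒯 l x₁) x₂ (𝒯 (n - i - j - l) x₃) +
               μ j x₁ (𝒯 l x₂) (𝒯 (n - i - j - l) x₃))) +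
        lam • (∑ i ∈ Finset.range (n + 1), ∑ j ∈ Finset.range (n - i + 1),
          𝒯 i (μ j (𝒯 (n - i - j) x₁) x₂ x₃ + μ j x₁ (𝒯 (n - i - j) x₂) x₃ +
               μ j x₁ x₂ (𝒯 (n - i - j) x₃))) +
        (lam * lam) • (∑ i ∈ Finset.range (n + 1), 𝒯 i (μ (n - i) x₁ x₂ x₃))

/-- An abelian extension `0 → (M, TM) → (E, fE, TE) → (g, f, T) → 0`
of Rota-Baxter 3-Lie algebras of weight `lam`. -/
structure IsAbelianExt (lam : k) (f : g → g → g → g) (T : g → g) (TM : M → M)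
    (fE : E → E → E → E) (TE : E → E) (i : M → E) (p : E → g) : Prop where
  base : IsRBThreeLie k lam f T
  total : IsRBThreeLie k lam fE TE
  linTM : IsLinearMap k TM
  lin_i : IsLinearMap k i
  lin_p : IsLinearMap k p
  i_rb : ∀ m, TE (i m) = i (TM m)
  p_bracket : ∀ a b c, p (fE a b c) = f (p a) (p b) (p c)
  p_rb : ∀ a, p (TE a) = T (p a)
  inj : Function.Injective i
  surj : Function.Surjective p
  exact : ∀ a, p a = 0 ↔ a ∈ Set.range i
  abelian : ∀ (w : E) (n q : M), fE w (i n) (i q) = 0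

/-- The semidirect-product type bracket on `g × M` twisted by `ψ`. -/
def extBracket (f : g → g → g → g) (ρ : g → g → M → M) (ψ : g → g → g → M) :
    g × M → g × M → g × M → g × M :=
  fun a b c =>
    (f a.1 b.1 c.1,
      ρ a.1 b.1 c.2 + ρ c.1 a.1 b.2 + ρ b.1 c.1 a.2 + ψ a.1 b.1 c.1)

/-- The operator on `g × M` twisted by `χ`. -/
def extOp (T : g → g) (χ : g → M) (TM : M → M) : g × M → g × M :=
  fun a => (T a.1, χ a.1 + TM a.2)

/-- A Rota-Baxter 3-Lie 2-algebra of weight `lam` on the data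
`(g₀, g₁, d, l3, l3m, l5, T0, T1, T2)`, where `l3m x y α` denotes the value of
the trilinear map `l3` with one argument `α` in `g₁` placed in the last slot
(the other placements being recovered by total skew-symmetry). -/
structure IsRB3Lie2Alg (lam : k) (d : g₁ → g₀) (l3 : g₀ → g₀ → g₀ → g₀)
    (l3m : g₀ → g₀ → g₁ → g₁) (l5 : g₀ → g₀ → g₀ → g₀ → g₀ → g₁)
    (T0 : g₀ → g₀) (T1 : g₁ → g₁) (T2 : g₀ → g₀ → g₀ → g₁) : Prop where
  lin_d : IsLinearMap k d
  tri_l3 : Trilinear k l3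
  alt_l3 : Alternating3 l3
  l3m_lin₁ : ∀ y α, IsLinearMap k fun x => l3m x y α
  l3m_lin₂ : ∀ x α, IsLinearMap k fun y => l3m x y α
  l3m_lin₃ : ∀ x y, IsLinearMap k (l3m x y)
  l3m_alt : ∀ x α, l3m x x α = 0
  l5_lin₁ : ∀ b c e e', IsLinearMap k fun a => l5 a b c e e'
  l5_lin₂ : ∀ a c e e', IsLinearMap k fun b => l5 a b c e e'
  l5_lin₃ : ∀ a b e e', IsLinearMap k fun c => l5 a b c e e'
  l5_lin₄ : ∀ a b c e', IsLinearMap k fun e => l5 a b c e e'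
  l5_lin₅ : ∀ a b c e, IsLinearMap k fun e' => l5 a b c e e'
  l5_alt₁₂ : ∀ a c e e', l5 a a c e e' = 0
  l5_alt₃₄ : ∀ a b c e', l5 a b c c e' = 0
  l5_alt₄₅ : ∀ a b c e, l5 a b c e e = 0
  l5_alt₃₅ : ∀ a b c e, l5 a b c e c = 0
  cond₁ : ∀ x y α, d (l3m x y α) = l3 x y (d α)
  cond₂ : ∀ x α β, l3m x (d α) β = - l3m x (d β) α
  cond₃ : ∀ x₁ x₂ x₃ x₄ x₅, d (l5 x₁ x₂ x₃ x₄ x₅) =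
    - l3 x₁ x₂ (l3 x₃ x₄ x₅) + l3 (l3 x₁ x₂ x₃) x₄ x₅ + l3 x₃ (l3 x₁ x₂ x₄) x₅ +
      l3 x₃ x₄ (l3 x₁ x₂ x₅)
  cond₄ : ∀ α x₂ x₃ x₄ x₅, l5 (d α) x₂ x₃ x₄ x₅ =
    - l3m x₂ (l3 x₃ x₄ x₅) α + l3m x₄ x₅ (l3m x₂ x₃ α) - l3m x₃ x₅ (l3m x₂ x₄ α) +
      l3m x₃ x₄ (l3m x₂ x₅ α)
  cond₅ : ∀ x₁ x₂ α x₄ x₅, l5 x₁ x₂ (d α) x₄ x₅ =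
    - l3m x₁ x₂ (l3m x₄ x₅ α) + l3m x₄ x₅ (l3m x₁ x₂ α) + l3m (l3 x₁ x₂ x₄) x₅ α +
      l3m x₄ (l3 x₁ x₂ x₅) α
  cond₆ : ∀ x₁ x₂ x₃ x₄ x₅ x₆ x₇,
    l3m x₆ x₇ (l5 x₁ x₂ x₃ x₄ x₅) - l3m x₅ x₇ (l5 x₁ x₂ x₃ x₄ x₆) +
      l3m x₁ x₂ (l5 x₃ x₄ x₅ x₆ x₇) + l3m x₅ x₆ (l5 x₁ x₂ x₃ x₄ x₇) +
      l5 x₁ x₂ (l3 x₃ x₄ x₅) x₆ x₇ + l5 x₁ x₂ x₅ (l3 x₃ x₄ x₆) x₇ +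
      l5 x₁ x₂ x₅ x₆ (l3 x₃ x₄ x₇) =
    l3m x₃ x₄ (l5 x₁ x₂ x₅ x₆ x₇) + l5 (l3 x₁ x₂ x₃) x₄ x₅ x₆ x₇ +
      l5 x₃ (l3 x₁ x₂ x₄) x₅ x₆ x₇ + l5 x₃ x₄ (l3 x₁ x₂ x₅) x₆ x₇ +
      l5 x₃ x₄ x₅ (l3 x₁ x₂ x₆) x₇ + l5 x₁ x₂ x₃ x₄ (l3 x₅ x₆ x₇) +
      l5 x₃ x₄ x₅ x₆ (l3 x₁ x₂ x₇)
  lin_T0 : IsLinearMap k T0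
  lin_T1 : IsLinearMap k T1
  T2_tri : Trilinear k T2
  T2_alt : Alternating3 T2
  condA : ∀ α, T0 (d α) = d (T1 α)
  condB : ∀ x y z,
    T0 (derBracket k lam l3 T0 x y z) - l3 (T0 x) (T0 y) (T0 z) = d (T2 x y z)
  condC : ∀ x y α,
    T1 (l3m (T0 x) (T0 y) α + l3m x (T0 y) (T1 α) + l3m (T0 x) y (T1 α) +
        lam • l3m (T0 x) y α + lam • l3m x (T0 y) α + lam • l3m x y (T1 α) +
        (lam * lam) • l3m x y α) -
      l3m (T0 x) (T0 y) (T1 α) = T2 x y (d α)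
  condD : ∀ x₁ x₂ x₃ x₄ x₅,
    l5 (T0 x₁) (T0 x₂) (T0 x₃) (T0 x₄) (T0 x₅) +
      l3m (T0 x₄) (T0 x₅) (T2 x₁ x₂ x₃) - l3m (T0 x₃) (T0 x₅) (T2 x₁ x₂ x₄) +
      l3m (T0 x₃) (T0 x₄) (T2 x₁ x₂ x₅) +
      T2 (derBracket k lam l3 T0 x₁ x₂ x₃) x₄ x₅ +
      T2 x₃ (derBracket k lam l3 T0 x₁ x₂ x₄) x₅ +
      T2 x₃ x₄ (derBracket k lam l3 T0 x₁ x₂ x₅) =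
    l3m (T0 x₁) (T0 x₂) (T2 x₃ x₄ x₅) + T2 x₁ x₂ (derBracket k lam l3 T0 x₃ x₄ x₅) +
      T1 (l5 x₁ x₂ x₃ x₄ x₅)

end Defs

end RBPaper

open RBPaper

/-- the derived bracket `[·,·,·]_T` of a Rota-Baxter 3-Lie algebra of
weight `lam` is an alternating trilinear map satisfying the Fundamental Identity,
i.e. `(g, [·,·,·]_T)` is a 3-Lie algebra. -/
theorem derBracket_is3LieAlgebra
    {k : Type*} [Field k] [CharZero k]
    {g : Type*} [AddCommGroup g] [Module k g]
    (lam : k) (f : g → g → g → g) (T : g → g)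
    (halg : IsRBThreeLie k lam f T) :
    Is3LieAlgebra k (derBracket k lam f T) := by
  obtain ⟨⟨⟨l1, l2, l3⟩, ⟨a12, a23, a13⟩, hfi⟩, lT, rb⟩ := halg
  have add1 : ∀ a b y z, f (a + b) y z = f a y z + f b y z := fun a b y z => (l1 y z).map_add a b
  have add2 : ∀ a b x z, f x (a + b) z = f x a z + f x b z := fun a b x z => (l2 x z).map_add a b
  have add3 : ∀ a b x y, f x y (a + b) = f x y a + f x y b := fun a b x y => (l3 x y).map_add a b
  have sm1 : ∀ (c : k) a y z, f (c • a) y z = c • f a y z := fun c a y z => (l1 y z).map_smul c a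
  have sm2 : ∀ (c : k) a x z, f x (c • a) z = c • f x a z := fun c a x z => (l2 x z).map_smul c a
  have sm3 : ∀ (c : k) a x y, f x y (c • a) = c • f x y a := fun c a x y => (l3 x y).map_smul c a
  have s12 : ∀ x y z, f x y z = - f y x z := by
    intro x y z
    have h := a12 (x + y) z
    simp only [add1, add2, a12, zero_add, add_zero] at h
    exact eq_neg_of_add_eq_zero_left h
  have s23 : ∀ x y z, f x y z = - f x z y := by
    intro x y z
    have h := a23 x (y + z)
    simp only [add3, add2, a23, zero_add, add_zero] at h
    exact eq_neg_of_add_eq_zero_right h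
  have s13 : ∀ x y z, f x y z = - f z y x := by
    intro x y z
    have h := a13 (x + z) y
    simp only [add1, add3, a13, zero_add, add_zero] at h
    exact eq_neg_of_add_eq_zero_left h
  refine ⟨⟨fun y z => ⟨fun a b => ?_, fun c a => ?_⟩, fun y z => ⟨fun a b => ?_, fun c a => ?_⟩,
    fun y z => ⟨fun a b => ?_, fun c a => ?_⟩⟩, ⟨fun x y => ?_, fun x y => ?_, fun x y => ?_⟩, ?_⟩
  iterate 6
    · simp only [derBracket, lT.map_add, lT.map_smul, add1, add2, add3, sm1, sm2, sm3]
      module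
  · simp only [derBracket, a12]
    rw [s12 x (T x) y, s12 x (T x) (T y)]
    module
  · simp only [derBracket, a23]
    rw [s23 x y (T y), s23 (T x) y (T y)]
    module
  · simp only [derBracket, a13]
    rw [s13 x y (T x), s13 x (T y) (T x)]
    module
  · intro x1 x2 x3 x4 x5
    have hT : ∀ x y z, T (derBracket k lam f T x y z) = f (T x) (T y) (T z) :=
      fun x y z => (rb x y z).symm
    have hD : ∀ x y z, derBracket k lam f T x y z = f (T x) (T y) z + f (T x) y (T z) +
      f x (T y) (T z) + lam • f (T x) y z + lam • f x (T y) z + lam • f x y (T z) +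
      (lam * lam) • f x y z := fun x y z => rfl
    rw [hD x1 x2 (derBracket k lam f T x3 x4 x5), hD (derBracket k lam f T x1 x2 x3),
      hD x3 (derBracket k lam f T x1 x2 x4), hD x3 x4 (derBracket k lam f T x1 x2 x5)]
    simp only [hT]
    simp only [hD, add1, add2, add3, sm1, sm2, sm3]
    linear_combination (norm := module) lam^4 • hfi x1 x2 x3 x4 x5 +
      lam^3 • hfi x1 x2 x3 x4 (T x5) +
      lam^3 • hfi x1 x2 x3 (T x4) x5 +
      lam^2 • hfi x1 x2 x3 (T x4) (T x5) +
      lam^3 • hfi x1 x2 (T x3) x4 x5 +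
      lam^2 • hfi x1 x2 (T x3) x4 (T x5) +
      lam^2 • hfi x1 x2 (T x3) (T x4) x5 +
      lam^1 • hfi x1 x2 (T x3) (T x4) (T x5) +
      lam^3 • hfi x1 (T x2) x3 x4 x5 +
      lam^2 • hfi x1 (T x2) x3 x4 (T x5) +
      lam^2 • hfi x1 (T x2) x3 (T x4) x5 +
      lam^1 • hfi x1 (T x2) x3 (T x4) (T x5) +
      lam^2 • hfi x1 (T x2) (T x3) x4 x5 +
      lam^1 • hfi x1 (T x2) (T x3) x4 (T x5) +
      lam^1 • hfi x1 (T x2) (T x3) (T x4) x5 +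
      (1:k) • hfi x1 (T x2) (T x3) (T x4) (T x5) +
      lam^3 • hfi (T x1) x2 x3 x4 x5 +
      lam^2 • hfi (T x1) x2 x3 x4 (T x5) +
      lam^2 • hfi (T x1) x2 x3 (T x4) x5 +
      lam^1 • hfi (T x1) x2 x3 (T x4) (T x5) +
      lam^2 • hfi (T x1) x2 (T x3) x4 x5 +
      lam^1 • hfi (T x1) x2 (T x3) x4 (T x5) +
      lam^1 • hfi (T x1) x2 (T x3) (T x4) x5 +
      (1:k) • hfi (T x1) x2 (T x3) (T x4) (T x5) +
      lam^2 • hfi (T x1) (T x2) x3 x4 x5 +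
      lam^1 • hfi (T x1) (T x2) x3 x4 (T x5) +
      lam^1 • hfi (T x1) (T x2) x3 (T x4) x5 +
      (1:k) • hfi (T x1) (T x2) x3 (T x4) (T x5) +
      lam^1 • hfi (T x1) (T x2) (T x3) x4 x5 +
      (1:k) • hfi (T x1) (T x2) (T x3) x4 (T x5) +
      (1:k) • hfi (T x1) (T x2) (T x3) (T x4) x5
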